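/- Let t ≥ 2 and t' > 4 be powers of 2, and let AD_{t,t'} = AD_t ∘ₜ AND_{log t'} : {-1,1}^{log t} × {-1,1}^{t·log t'} → {-1,1}. Then: r(AD_{t,t'}) = t·log t' + log t; k(AD_{t,t'}) = 1 + t²·(t' − 1); k'(AD_{t,t'}) = k''(AD_{t,t'}) = t·t'/2; and δ(AD_{t,t'}) = 1/t'. -/

import Mathlib

open scoped BigOperators
open scoped Classical

noncomputable section

namespace BoolFunc

/-- Real value of a hypercube coordinate: `true ↦ -1`, `false ↦ 1`. -/
def signv (b : Bool) : ℝ := if b then -1 else 1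

/-- Fourier coefficient `f̂(S)` of `f : {-1,1}ⁿ → ℝ`. -/
def fourierCoeff {n : ℕ} (f : (Fin n → Bool) → ℝ) (S : Finset (Fin n)) : ℝ :=
  (∑ x : Fin n → Bool, f x * ∏ i ∈ S, signv (x i)) / 2 ^ n

/-- Fourier support of `f`. -/
def fourierSupport {n : ℕ} (f : (Fin n → Bool) → ℝ) : Finset (Finset (Fin n)) :=
  Finset.univ.filter (fun S => fourierCoeff f S ≠ 0)

/-- Fourier sparsity `k(f)`. -/
def sparsity {n : ℕ} (f : (Fin n → Bool) → ℝ) : ℕ := (fourierSupport f).card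

/-- Indicator vector in `F₂ⁿ` of a subset of `[n]`. -/
def indicatorVec {n : ℕ} (S : Finset (Fin n)) : Fin n → ZMod 2 :=
  fun i => if i ∈ S then 1 else 0

/-- Fourier rank `r(f)`: the `F₂`-dimension of the span of the Fourier support. -/
def fourierRank {n : ℕ} (f : (Fin n → Bool) → ℝ) : ℕ :=
  Module.finrank (ZMod 2)
    ↥(Submodule.span (ZMod 2)
      (indicatorVec '' (fourierSupport f : Set (Finset (Fin n)))))

/-- Weight `δ(f) = Pr[f(x) = -1]`. -/
def weight {n : ℕ} (f : (Fin n → Bool) → ℝ) : ℝ :=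
  ((Finset.univ.filter (fun x : Fin n → Bool => f x = -1)).card : ℝ) / 2 ^ n

/-- Fourier max-supp-entropy `k'(f) = max_{S ∈ supp(f)} 1/|f̂(S)|`. -/
def maxSuppEntropy {n : ℕ} (f : (Fin n → Bool) → ℝ) : ℝ :=
  sSup ((fun S => 1 / |fourierCoeff f S|) '' (fourierSupport f : Set (Finset (Fin n))))

/-- Dimension of the span of `{S : |f̂(S)| ≥ 1/t}`. -/
def levelDim {n : ℕ} (f : (Fin n → Bool) → ℝ) (t : ℝ) : ℕ :=
  Module.finrank (ZMod 2)
    ↥(Submodule.span (ZMod 2)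
      (indicatorVec '' {S : Finset (Fin n) | 1 / t ≤ |fourierCoeff f S|}))

/-- Fourier max-rank-entropy `k''(f)`. -/
def maxRankEntropy {n : ℕ} (f : (Fin n → Bool) → ℝ) : ℝ :=
  sInf {t : ℝ | 0 < t ∧ levelDim f t = fourierRank f}

/-- `f` is Boolean-valued (takes values in `{-1,1}`). -/
def IsBooleanFunc {n : ℕ} (f : (Fin n → Bool) → ℝ) : Prop := ∀ x, f x = 1 ∨ f x = -1

/-- `bin(x) ∈ [t]`, reading `-1` (i.e. `true`) as bit `1` and `1` (i.e. `false`) as bit `0`. -/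
def binIdx (τ : ℕ) (v : Fin τ → Bool) : Fin (2 ^ τ) :=
  finFunctionFinEquiv (fun i => if v i then (1 : Fin 2) else 0)

/-- The composed Addressing function `AD_t ∘ₜ g`, where `t = 2^τ` and each of the `t` target
variables is replaced by a copy of `g` on its own fresh block of `m` variables. -/
def ADcomp (τ m : ℕ) (g : (Fin m → Bool) → ℝ) : (Fin (τ + 2 ^ τ * m) → Bool) → ℝ :=
  fun x =>
    g (fun l =>
      x (Fin.natAdd τ (finProdFinEquiv
        (binIdx τ (fun i => x (Fin.castAdd (2 ^ τ * m) i)), l))))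

/-- `AND_m : {-1,1}^m → {-1,1}`, taking the value `-1` exactly at `(-1,…,-1)`. -/
def ANDf (m : ℕ) : (Fin m → Bool) → ℝ := fun x => if ∀ i, x i = true then -1 else 1

/-- The Fourier character `χ_S`. -/
def character {n : ℕ} (S : Finset (Fin n)) (x : Fin n → Bool) : ℝ := ∏ i ∈ S, signv (x i)

theorem abs_character {n : ℕ} (S : Finset (Fin n)) (x : Fin n → Bool) :
    |character S x| = 1 := by
  rw [character, Finset.abs_prod]
  refine Finset.prod_eq_one fun i _ => ?_
  cases x i <;> simp [signv]

/-- The (unnormalised) Fourier transform of the indicator of a subcube. -/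
theorem sum_subcube_character {n : ℕ} (A S : Finset (Fin n)) (c : Fin n → Bool) :
    ∑ x : Fin n → Bool, (if ∀ i ∈ A, x i = c i then (1 : ℝ) else 0) * character S x =
      if S ⊆ A then 2 ^ (n - A.card) * character S c else 0 := by
  have hprod : ∀ x : Fin n → Bool,
      (if ∀ i ∈ A, x i = c i then (1 : ℝ) else 0) * character S x =
        ∏ i, ((if i ∈ A then (if x i = c i then (1 : ℝ) else 0) else 1) *
          (if i ∈ S then signv (x i) else 1)) := by
    intro x
    rw [Finset.prod_mul_distrib, character, Finset.prod_ite_mem, Finset.prod_ite_mem,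
      Finset.univ_inter, Finset.univ_inter, Finset.prod_boole]
    congr
  simp_rw [hprod]
  have hswap := Finset.prod_univ_sum (fun _ : Fin n => (Finset.univ : Finset Bool))
    (fun i b => (if i ∈ A then (if b = c i then (1 : ℝ) else 0) else 1) *
      (if i ∈ S then signv b else 1))
  rw [Fintype.piFinset_univ] at hswap
  rw [← hswap]
  have hfactor : ∀ i : Fin n, (∑ b : Bool, (if i ∈ A then (if b = c i then (1 : ℝ) else 0) else 1) *
      (if i ∈ S then signv b else 1)) =
        if i ∈ A then (if i ∈ S then signv (c i) else 1) else (if i ∈ S then 0 else 2) := by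
    intro i
    by_cases hA : i ∈ A <;> by_cases hS : i ∈ S <;> cases c i <;> simp [hA, hS, signv]
  simp_rw [hfactor]
  split_ifs with hSA
  · rw [Finset.prod_ite, character]
    have hin : (∏ i ∈ Finset.univ.filter (fun i => i ∈ A), if i ∈ S then signv (c i) else 1) =
        ∏ i ∈ S, signv (c i) := by
      rw [Finset.prod_ite_mem]
      congr 1
      ext i
      simpa using fun h => hSA h
    have hout : (∏ i ∈ Finset.univ.filter (fun i => i ∉ A), if i ∈ S then (0 : ℝ) else 2) =
        2 ^ (n - A.card) := by
      rw [Finset.prod_congr rfl (g := fun _ => (2 : ℝ))]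
      · rw [Finset.prod_const]
        congr 1
        have : Finset.univ.filter (fun i => i ∉ A) = Aᶜ := by ext; simp
        rw [this, Finset.card_compl, Fintype.card_fin]
      · intro i hi
        have : i ∉ S := fun h => (Finset.mem_filter.1 hi).2 (hSA h)
        simp [this]
    rw [hin, hout, mul_comm]
  · obtain ⟨i, hiS, hiA⟩ := Finset.not_subset.1 hSA
    exact Finset.prod_eq_zero (Finset.mem_univ i) (by simp [hiS, hiA])

theorem sum_character {n : ℕ} (S : Finset (Fin n)) :
    ∑ x : Fin n → Bool, character S x = if S = ∅ then 2 ^ n else 0 := by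
  have h := sum_subcube_character ∅ S (fun _ => true)
  simp only [Finset.notMem_empty, false_imp_iff, implies_true, if_true, one_mul,
    Finset.subset_empty, Finset.card_empty, Nat.sub_zero] at h
  rw [h]
  split_ifs with hS
  · simp [hS, character]
  · rfl

theorem binIdx_bijective (τ : ℕ) : Function.Bijective (binIdx τ) := by
  have hinj : Function.Injective (binIdx τ) := by
    intro v w h
    have h' := finFunctionFinEquiv.injective h
    funext i
    have hi := congrFun h' i
    cases hv : v i <;> cases hw : w i <;> simp_all
  exact (Fintype.bijective_iff_injective_and_card _).2 ⟨hinj, by simp⟩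

/-- The address coordinates. -/
def addrSet (τ m : ℕ) : Finset (Fin (τ + 2 ^ τ * m)) :=
  Finset.univ.map (Fin.castAddEmb (2 ^ τ * m))

/-- The `l`-th coordinate of the target block with address `v`. -/
def target {τ m : ℕ} (v : Fin τ → Bool) (l : Fin m) : Fin (τ + 2 ^ τ * m) :=
  Fin.natAdd τ (finProdFinEquiv (binIdx τ v, l))

theorem target_inj {τ m : ℕ} {v w : Fin τ → Bool} {l k : Fin m} :
    target v l = target w k ↔ v = w ∧ l = k := by
  simp [target, (binIdx_bijective τ).1.eq_iff]

/-- The address coordinates together with the target block with address `v`. -/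
def relevantSet {τ : ℕ} (m : ℕ) (v : Fin τ → Bool) : Finset (Fin (τ + 2 ^ τ * m)) :=
  addrSet τ m ∪ Finset.univ.map ⟨target v, fun _ _ h => (target_inj.1 h).2⟩

theorem mem_addrSet {τ m : ℕ} {i : Fin (τ + 2 ^ τ * m)} :
    i ∈ addrSet τ m ↔ ∃ j, Fin.castAdd (2 ^ τ * m) j = i := by
  simp [addrSet]

theorem mem_relevantSet {τ m : ℕ} {v : Fin τ → Bool} {i : Fin (τ + 2 ^ τ * m)} :
    i ∈ relevantSet m v ↔ i ∈ addrSet τ m ∨ ∃ l, target v l = i := by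
  simp only [relevantSet, Finset.mem_union, Finset.mem_map, Finset.mem_univ, true_and]
  rfl

theorem target_notMem_addrSet {τ m : ℕ} (v : Fin τ → Bool) (l : Fin m) :
    target v l ∉ addrSet τ m := by
  rw [mem_addrSet]
  rintro ⟨j, hj⟩
  have := congrArg Fin.val hj
  simp only [Fin.val_castAdd, target, Fin.val_natAdd] at this
  omega

theorem addrSet_subset_relevantSet {τ m : ℕ} (v : Fin τ → Bool) :
    addrSet τ m ⊆ relevantSet m v :=
  Finset.subset_union_left

theorem card_addrSet (τ m : ℕ) : (addrSet τ m).card = τ := by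
  simp [addrSet]

theorem card_relevantSet {τ m : ℕ} (v : Fin τ → Bool) : (relevantSet m v).card = τ + m := by
  rw [relevantSet, Finset.card_union_of_disjoint, card_addrSet, Finset.card_map, Finset.card_univ,
    Fintype.card_fin]
  rw [Finset.disjoint_right]
  intro i hi
  obtain ⟨l, -, rfl⟩ := Finset.mem_map.1 hi
  exact target_notMem_addrSet v l

theorem eq_of_mem_relevantSet {τ m : ℕ} {v w : Fin τ → Bool} {i : Fin (τ + 2 ^ τ * m)}
    (hi : i ∉ addrSet τ m) (hv : i ∈ relevantSet m v) (hw : i ∈ relevantSet m w) : v = w := by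
  obtain ⟨l, hl⟩ := (mem_relevantSet.1 hv).resolve_left hi
  obtain ⟨k, hk⟩ := (mem_relevantSet.1 hw).resolve_left hi
  exact (target_inj.1 (hl.trans hk.symm)).1

theorem ADcomp_ANDf_eq (τ m : ℕ) (x : Fin (τ + 2 ^ τ * m) → Bool) :
    ADcomp τ m (ANDf m) x = 1 - 2 * ∑ v : Fin τ → Bool,
      if ∀ i ∈ relevantSet m v, x i = Fin.append v (fun _ => true) i then (1 : ℝ) else 0 := by
  have hiff : ∀ v : Fin τ → Bool,
      (∀ i ∈ relevantSet m v, x i = Fin.append v (fun _ => true) i) ↔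
        (fun j => x (Fin.castAdd (2 ^ τ * m) j)) = v ∧ ∀ l, x (target v l) = true := by
    intro v
    constructor
    · intro h
      refine ⟨funext fun j => ?_, fun l => ?_⟩
      · have := h _ (addrSet_subset_relevantSet v (mem_addrSet.2 ⟨j, rfl⟩))
        rwa [Fin.append_left] at this
      · have := h (target v l) (mem_relevantSet.2 (Or.inr ⟨l, rfl⟩))
        rwa [target, Fin.append_right] at this
    · rintro ⟨h1, h2⟩ i hi
      rcases mem_relevantSet.1 hi with hi | ⟨l, rfl⟩
      · obtain ⟨j, rfl⟩ := mem_addrSet.1 hi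
        rw [Fin.append_left, ← h1]
      · rw [h2 l, target, Fin.append_right]
  simp_rw [hiff, ite_and]
  rw [Finset.sum_ite_eq]
  simp only [Finset.mem_univ, if_true, ADcomp, ANDf]
  by_cases h : ∀ l : Fin m, x (target (fun j => x (Fin.castAdd (2 ^ τ * m) j)) l) = true
  · rw [if_pos h]
    exact (if_pos h).trans (by norm_num)
  · rw [if_neg h]
    exact (if_neg h).trans (by norm_num)

theorem fourierCoeff_eq (τ m : ℕ) (S : Finset (Fin (τ + 2 ^ τ * m))) :
    fourierCoeff (ADcomp τ m (ANDf m)) S = (if S = ∅ then 1 else 0) -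
      2 / (2 ^ τ * 2 ^ m) * ∑ v : Fin τ → Bool,
        if S ⊆ relevantSet m v then character S (Fin.append v (fun _ => true)) else 0 := by
  have hle : τ + m ≤ τ + 2 ^ τ * m := by
    have := Nat.le_mul_of_pos_left m (Nat.two_pow_pos τ)
    omega
  have hsum : ∑ x, ADcomp τ m (ANDf m) x * character S x =
      (if S = ∅ then 2 ^ (τ + 2 ^ τ * m) else 0) -
        2 * (2 ^ (τ + 2 ^ τ * m - (τ + m)) * ∑ v : Fin τ → Bool,
          if S ⊆ relevantSet m v then character S (Fin.append v (fun _ => true)) else 0) := by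
    simp_rw [ADcomp_ANDf_eq, sub_mul, one_mul, mul_assoc, Finset.sum_mul]
    rw [Finset.sum_sub_distrib, sum_character, ← Finset.mul_sum, Finset.sum_comm]
    simp_rw [sum_subcube_character, card_relevantSet]
    simp only [Finset.mul_sum, mul_ite, mul_zero]
  change (∑ x, ADcomp τ m (ANDf m) x * character S x) / 2 ^ (τ + 2 ^ τ * m) = _
  rw [hsum, pow_sub₀ _ two_ne_zero hle, sub_div, pow_add 2 τ m]
  congr 1
  · split_ifs <;> simp
  · field_simp

theorem fourierCoeff_empty (τ m : ℕ) :
    fourierCoeff (ADcomp τ m (ANDf m)) ∅ = 1 - 2 / 2 ^ m := by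
  rw [fourierCoeff_eq]
  simp only [if_true, Finset.empty_subset, character, Finset.prod_empty, Finset.sum_const,
    Finset.card_univ, Fintype.card_pi, Fintype.card_bool, Finset.prod_const, Fintype.card_fin,
    nsmul_eq_mul, mul_one]
  push_cast
  field_simp

theorem fourierCoeff_of_subset_addrSet {τ m : ℕ} {S : Finset (Fin (τ + 2 ^ τ * m))}
    (hne : S ≠ ∅) (hS : S ⊆ addrSet τ m) : fourierCoeff (ADcomp τ m (ANDf m)) S = 0 := by
  obtain ⟨U, -, rfl⟩ := Finset.subset_map_iff.1 hS
  have hU : U ≠ ∅ := by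
    rintro rfl
    exact hne (Finset.map_empty _)
  rw [fourierCoeff_eq, if_neg hne]
  have hchar : ∀ v : Fin τ → Bool, character (U.map (Fin.castAddEmb (2 ^ τ * m)))
      (Fin.append v (fun _ => true)) = character U v := by
    intro v
    simp [character, Finset.prod_map]
  have hsub : ∀ v, U.map (Fin.castAddEmb (2 ^ τ * m)) ⊆ relevantSet m v :=
    fun v => hS.trans (addrSet_subset_relevantSet v)
  simp [hchar, hsub, sum_character, hU]

theorem abs_fourierCoeff_of_subset {τ m : ℕ} {S : Finset (Fin (τ + 2 ^ τ * m))}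
    {v : Fin τ → Bool} (hS : ¬ S ⊆ addrSet τ m) (hv : S ⊆ relevantSet m v) :
    |fourierCoeff (ADcomp τ m (ANDf m)) S| = 2 / (2 ^ τ * 2 ^ m) := by
  obtain ⟨i, hiS, hi⟩ := Finset.not_subset.1 hS
  have hne : S ≠ ∅ := Finset.ne_empty_of_mem hiS
  rw [fourierCoeff_eq, if_neg hne, Finset.sum_eq_single v, if_pos hv, zero_sub, abs_neg, abs_mul,
    abs_character, mul_one, abs_of_pos (by positivity)]
  · intro w _ hw
    exact if_neg fun h => hw (eq_of_mem_relevantSet hi (h hiS) (hv hiS))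
  · simp

theorem fourierCoeff_of_not_subset {τ m : ℕ} {S : Finset (Fin (τ + 2 ^ τ * m))}
    (hne : S ≠ ∅) (hS : ∀ v, ¬ S ⊆ relevantSet m v) :
    fourierCoeff (ADcomp τ m (ANDf m)) S = 0 := by
  simp [fourierCoeff_eq, hne, hS]

theorem one_sub_two_div_two_pow_pos {m : ℕ} (hm : 2 ≤ m) : (0 : ℝ) < 1 - 2 / 2 ^ m := by
  have h : (2 : ℝ) ^ 2 ≤ 2 ^ m := pow_le_pow_right₀ one_le_two hm
  rw [sub_pos, div_lt_one (by positivity)]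
  linarith

theorem fourierSupport_eq {τ m : ℕ} (hm : 2 ≤ m) :
    fourierSupport (ADcomp τ m (ANDf m)) = insert ∅ (Finset.univ.biUnion
      fun v : Fin τ → Bool => (relevantSet m v).powerset \ (addrSet τ m).powerset) := by
  ext S
  simp only [fourierSupport, Finset.mem_filter, Finset.mem_univ, true_and, Finset.mem_insert,
    Finset.mem_biUnion, Finset.mem_sdiff, Finset.mem_powerset]
  constructor
  · intro h
    by_contra hcon
    rw [not_or, not_exists] at hcon
    by_cases hS : S ⊆ addrSet τ m
    · exact h (fourierCoeff_of_subset_addrSet hcon.1 hS)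
    · exact h (fourierCoeff_of_not_subset hcon.1 fun v hv => hcon.2 v ⟨hv, hS⟩)
  · rintro (rfl | ⟨v, hv, hS⟩)
    · rw [fourierCoeff_empty]
      exact (one_sub_two_div_two_pow_pos hm).ne'
    · rw [← abs_pos, abs_fourierCoeff_of_subset hS hv]
      positivity

theorem sparsity_ADcomp_ANDf {τ m : ℕ} (hm : 2 ≤ m) :
    sparsity (ADcomp τ m (ANDf m)) = 1 + (2 ^ τ) ^ 2 * (2 ^ m - 1) := by
  rw [sparsity, fourierSupport_eq hm, Finset.card_insert_of_notMem (by simp),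
    Finset.card_biUnion]
  · have hcard : ∀ v : Fin τ → Bool,
        ((relevantSet m v).powerset \ (addrSet τ m).powerset).card = 2 ^ τ * (2 ^ m - 1) := by
      intro v
      rw [Finset.card_sdiff_of_subset (Finset.powerset_mono.2 (addrSet_subset_relevantSet v)),
        Finset.card_powerset, Finset.card_powerset, card_relevantSet, card_addrSet, Nat.mul_sub,
        mul_one, pow_add]
    simp only [hcard, Finset.sum_const, Finset.card_univ, Fintype.card_pi, Fintype.card_bool,
      Finset.prod_const, Fintype.card_fin, smul_eq_mul]
    ring
  · intro v _ w _ hvw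
    rw [Function.onFun, Finset.disjoint_left]
    intro S hSv hSw
    simp only [Finset.mem_sdiff, Finset.mem_powerset] at hSv hSw
    obtain ⟨i, hiS, hi⟩ := Finset.not_subset.1 hSv.2
    exact hvw (eq_of_mem_relevantSet hi (hSv.1 hiS) (hSw.1 hiS))

theorem finrank_span_indicatorVec {τ m : ℕ} (hm : 1 ≤ m)
    (P : Set (Finset (Fin (τ + 2 ^ τ * m))))
    (hP : ∀ S v, ¬ S ⊆ addrSet τ m → S ⊆ relevantSet m v → S ∈ P) :
    Module.finrank (ZMod 2) ↥(Submodule.span (ZMod 2) (indicatorVec '' P)) = 2 ^ τ * m + τ := by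
  have htarget : ∀ (v : Fin τ → Bool) (l : Fin m),
      indicatorVec {target v l} ∈ Submodule.span (ZMod 2) (indicatorVec '' P) := by
    intro v l
    refine Submodule.subset_span ⟨_, hP _ v ?_ ?_, rfl⟩
    · simpa using target_notMem_addrSet v l
    · simpa using mem_relevantSet.2 (Or.inr ⟨l, rfl⟩)
  have hsingle : ∀ i, indicatorVec {i} ∈ Submodule.span (ZMod 2) (indicatorVec '' P) := by
    intro i
    induction i using Fin.addCases with
    | left j =>
      let w : Fin (τ + 2 ^ τ * m) := target (fun _ => true) ⟨0, hm⟩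
      have hj : Fin.castAdd (2 ^ τ * m) j ∈ addrSet τ m := mem_addrSet.2 ⟨j, rfl⟩
      have hw : w ∉ addrSet τ m := target_notMem_addrSet _ _
      have hpair : indicatorVec {Fin.castAdd (2 ^ τ * m) j, w} ∈
          Submodule.span (ZMod 2) (indicatorVec '' P) := by
        refine Submodule.subset_span ⟨_, hP _ (fun _ => true) ?_ ?_, rfl⟩
        · exact fun h => hw (h (by simp))
        · intro i hi
          rcases Finset.mem_insert.1 hi with rfl | hi
          · exact addrSet_subset_relevantSet _ hj
          · rw [Finset.mem_singleton.1 hi]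
            exact mem_relevantSet.2 (Or.inr ⟨_, rfl⟩)
      have hne : Fin.castAdd (2 ^ τ * m) j ≠ w := fun h => hw (h ▸ hj)
      have hsub : indicatorVec {Fin.castAdd (2 ^ τ * m) j} =
          indicatorVec {Fin.castAdd (2 ^ τ * m) j, w} - indicatorVec {w} := by
        funext i
        by_cases h1 : i = Fin.castAdd (2 ^ τ * m) j
        · subst h1
          simp [indicatorVec, hne]
        · by_cases h2 : i = w <;> simp [indicatorVec, h1, h2, hne.symm]
      rw [hsub]
      exact Submodule.sub_mem _ hpair (htarget _ _)
    | right k =>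
      obtain ⟨⟨a, l⟩, rfl⟩ := finProdFinEquiv.surjective k
      obtain ⟨v, rfl⟩ := (binIdx_bijective τ).2 a
      exact htarget v l
  have htop : Submodule.span (ZMod 2) (indicatorVec '' P) = ⊤ := by
    rw [eq_top_iff, ← (Pi.basisFun (ZMod 2) (Fin (τ + 2 ^ τ * m))).span_eq, Submodule.span_le]
    rintro _ ⟨i, rfl⟩
    have : Pi.basisFun (ZMod 2) (Fin (τ + 2 ^ τ * m)) i = indicatorVec {i} := by
      funext j
      simp [indicatorVec, Pi.single_apply]
    rw [this]
    exact hsingle i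
  rw [htop, finrank_top, Module.finrank_fin_fun, add_comm]

theorem fourierRank_ADcomp_ANDf {τ m : ℕ} (hm : 1 ≤ m) :
    fourierRank (ADcomp τ m (ANDf m)) = 2 ^ τ * m + τ := by
  refine finrank_span_indicatorVec hm _ fun S v hS hv => ?_
  rw [Finset.mem_coe, fourierSupport, Finset.mem_filter, ← abs_pos,
    abs_fourierCoeff_of_subset hS hv]
  exact ⟨Finset.mem_univ _, by positivity⟩

theorem exists_subset_relevantSet (τ : ℕ) {m : ℕ} (hm : 1 ≤ m) :
    ∃ (S : Finset (Fin (τ + 2 ^ τ * m))) (v : Fin τ → Bool),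
      ¬ S ⊆ addrSet τ m ∧ S ⊆ relevantSet m v :=
  ⟨{target (fun _ => true) ⟨0, hm⟩}, fun _ => true,
    by simpa using target_notMem_addrSet _ _,
    by simpa using mem_relevantSet.2 (Or.inr ⟨_, rfl⟩)⟩

theorem maxSuppEntropy_ADcomp_ANDf {τ m : ℕ} (hτ : 1 ≤ τ) (hm : 2 ≤ m) :
    maxSuppEntropy (ADcomp τ m (ANDf m)) = (2 ^ τ : ℝ) * 2 ^ m / 2 := by
  have hmax : IsGreatest ((fun S => 1 / |fourierCoeff (ADcomp τ m (ANDf m)) S|) ''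
      (fourierSupport (ADcomp τ m (ANDf m)) : Set (Finset (Fin (τ + 2 ^ τ * m)))))
      ((2 ^ τ : ℝ) * 2 ^ m / 2) := by
    rw [fourierSupport_eq hm]
    constructor
    · obtain ⟨S, v, hS, hv⟩ := exists_subset_relevantSet τ (one_le_two.trans hm)
      refine ⟨S, ?_, ?_⟩
      · simp only [Finset.mem_coe, Finset.mem_insert, Finset.mem_biUnion, Finset.mem_univ,
          true_and, Finset.mem_sdiff, Finset.mem_powerset]
        exact Or.inr ⟨v, hv, hS⟩
      · simp only [abs_fourierCoeff_of_subset hS hv, one_div_div]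
    · rintro _ ⟨S, hS, rfl⟩
      simp only [Finset.mem_coe, Finset.mem_insert, Finset.mem_biUnion, Finset.mem_univ,
        true_and, Finset.mem_sdiff, Finset.mem_powerset] at hS
      rcases hS with rfl | ⟨v, hv, hS⟩
      · have hpos := one_sub_two_div_two_pow_pos hm
        have h1 : (2 : ℝ) ^ 2 ≤ 2 ^ m := pow_le_pow_right₀ one_le_two hm
        have h2 : (2 : ℝ) ^ 1 ≤ 2 ^ τ := pow_le_pow_right₀ one_le_two hτ
        have h3 : (2 : ℝ) / 2 ^ m ≤ 1 / 2 := by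
          rw [div_le_div_iff₀ (by positivity) two_pos]
          linarith
        simp only [fourierCoeff_empty, abs_of_pos hpos]
        calc 1 / (1 - 2 / 2 ^ m) ≤ (2 : ℝ) := by
              rw [div_le_iff₀ hpos]
              linarith
          _ ≤ 2 ^ τ * 2 ^ m / 2 := by nlinarith
      · simp only [abs_fourierCoeff_of_subset hS hv, one_div_div, le_refl]
  exact hmax.csSup_eq

theorem abs_fourierCoeff_le {τ m : ℕ} {S : Finset (Fin (τ + 2 ^ τ * m))} (hne : S ≠ ∅) :
    |fourierCoeff (ADcomp τ m (ANDf m)) S| ≤ 2 / (2 ^ τ * 2 ^ m) := by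
  have hpos : (0 : ℝ) ≤ 2 / (2 ^ τ * 2 ^ m) := by positivity
  by_cases hS : S ⊆ addrSet τ m
  · rwa [fourierCoeff_of_subset_addrSet hne hS, abs_zero]
  · by_cases hv : ∃ v, S ⊆ relevantSet m v
    · obtain ⟨v, hv⟩ := hv
      exact (abs_fourierCoeff_of_subset hS hv).le
    · rwa [fourierCoeff_of_not_subset hne (not_exists.1 hv), abs_zero]

theorem maxRankEntropy_ADcomp_ANDf {τ m : ℕ} (hm : 1 ≤ m) :
    maxRankEntropy (ADcomp τ m (ANDf m)) = (2 ^ τ : ℝ) * 2 ^ m / 2 := by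
  have hmin : IsLeast {t : ℝ | 0 < t ∧
      levelDim (ADcomp τ m (ANDf m)) t = fourierRank (ADcomp τ m (ANDf m))}
      ((2 ^ τ : ℝ) * 2 ^ m / 2) := by
    constructor
    · refine ⟨by positivity, ?_⟩
      rw [fourierRank_ADcomp_ANDf hm]
      refine finrank_span_indicatorVec hm _ fun S v hS hv => ?_
      rw [Set.mem_ofPred_eq, abs_fourierCoeff_of_subset hS hv, one_div_div]
    · rintro t ⟨ht, hdim⟩
      by_contra! hlt
      have hbot : Submodule.span (ZMod 2) (indicatorVec ''
          {S : Finset (Fin (τ + 2 ^ τ * m)) |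
            1 / t ≤ |fourierCoeff (ADcomp τ m (ANDf m)) S|}) = ⊥ := by
        rw [Submodule.span_eq_bot]
        rintro _ ⟨S, hS, rfl⟩
        have hS_empty : S = ∅ := by
          by_contra hne
          have h := one_div_lt_one_div_of_lt ht hlt
          rw [one_div_div] at h
          exact absurd (le_trans hS (abs_fourierCoeff_le hne)) (not_le.2 h)
        funext i
        simp [hS_empty, indicatorVec]
      rw [fourierRank_ADcomp_ANDf hm, levelDim, hbot, finrank_bot] at hdim
      have : 0 < 2 ^ τ * m := by positivity
      omega
  exact hmin.csInf_eq

theorem weight_eq_of_isBooleanFunc {n : ℕ} {f : (Fin n → Bool) → ℝ} (hf : IsBooleanFunc f) :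
    weight f = (1 - fourierCoeff f ∅) / 2 := by
  have hsum : ∑ x, f x = 2 ^ n -
      2 * ((Finset.univ.filter fun x : Fin n → Bool => f x = -1).card : ℝ) := by
    have hpt : ∀ x, f x = 1 - 2 * (if f x = -1 then (1 : ℝ) else 0) := by
      intro x
      rcases hf x with h | h <;> rw [h] <;> norm_num
    rw [Finset.sum_congr rfl fun x _ => hpt x, Finset.sum_sub_distrib, ← Finset.mul_sum,
      Finset.sum_boole]
    simp
  rw [weight, fourierCoeff]
  simp only [Finset.prod_empty, mul_one]
  rw [hsum]
  field_simp
  ring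

theorem weight_ADcomp_ANDf (τ m : ℕ) : weight (ADcomp τ m (ANDf m)) = 1 / 2 ^ m := by
  rw [weight_eq_of_isBooleanFunc, fourierCoeff_empty]
  · ring
  · intro x
    rw [ADcomp, ANDf]
    split_ifs <;> simp

/-- **Claim (properties of `AD_{t,t'}`).** For `t = 2^τ ≥ 2` and `t' = 2^σ > 4`
(powers of `2`), the function `AD_{t,t'} = AD_t ∘ₜ AND_{log t'}` satisfies
`r = t·log t' + log t`, `k = 1 + t²(t' - 1)`, `k' = k'' = t·t'/2`, `δ = 1/t'`. -/
theorem ADtt'_measures (τ σ : ℕ) (hτ : 1 ≤ τ) (hσ : 3 ≤ σ) :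
    fourierRank (ADcomp τ σ (ANDf σ)) = 2 ^ τ * σ + τ ∧
    sparsity (ADcomp τ σ (ANDf σ)) = 1 + (2 ^ τ) ^ 2 * (2 ^ σ - 1) ∧
    maxSuppEntropy (ADcomp τ σ (ANDf σ)) = (2 ^ τ : ℝ) * 2 ^ σ / 2 ∧
    maxRankEntropy (ADcomp τ σ (ANDf σ)) = (2 ^ τ : ℝ) * 2 ^ σ / 2 ∧
    weight (ADcomp τ σ (ANDf σ)) = 1 / 2 ^ σ := by
  exact ⟨fourierRank_ADcomp_ANDf (by omega), sparsity_ADcomp_ANDf (by omega),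
    maxSuppEntropy_ADcomp_ANDf hτ (by omega), maxRankEntropy_ADcomp_ANDf (by omega),
    weight_ADcomp_ANDf τ σ⟩

end BoolFunc

end
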